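/- Fix a finite metric space X. For all finite metric spaces A and B such that X is a metric subspace of A and A is a metric subspace of B, every nonempty finite set F ⊆ Emb_X(A,B) of isometric embeddings of A into B fixing X pointwise, and every ε > 0, there exists a finite metric space C containing X as a metric subspace such that for every coloring γ of Emb_X(A,C) there exists β ∈ Emb_X(B,C) such that the oscillation of γ on {β∘α : α ∈ F} is less than ε. -/

import Mathlib

open Set

/-- A bundled finite metric space. -/
structure FinMetricSpace : Type 1 where
  carrier : Type
  [metric : MetricSpace carrier]
  [fin : Finite carrier]

attribute [instance] FinMetricSpace.metric FinMetricSpace.fin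

/-- The sup-distance `ρ(α, β) = sup_{a ∈ A} d(α a, β a)` between two maps defined on `A`. -/
noncomputable def embDist {A Y : Type*} [MetricSpace Y] (α β : A → Y) : ℝ :=
  ⨆ a : A, dist (α a) (β a)

/-- A coloring of a family `S` of maps: a `[0,1]`-valued map which is `1`-Lipschitz for the
sup-distance on `S`. -/
def IsColoringOn {A Y : Type*} [MetricSpace Y] (S : Set (A → Y)) (γ : (A → Y) → ℝ) : Prop :=
  (∀ α ∈ S, γ α ∈ Set.Icc (0 : ℝ) 1) ∧
    ∀ α ∈ S, ∀ β ∈ S, |γ α - γ β| ≤ embDist α β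

theorem exists_sum_sq_sub_le {G : Type*} [Fintype G] [Nonempty G] {c : ℝ} (n : ℕ)
    (f : (Fin n → G) → ℝ)
    (hf : ∀ x k y, |f x - f (Function.update x k y)| ≤ c) :
    ∃ m : ℝ, ∑ x, (f x - m) ^ 2 ≤ n * c ^ 2 * (Fintype.card G : ℝ) ^ n := by
  induction n with
  | zero => exact ⟨f default, by simp⟩
  | succ n ih =>
    have hN : (0 : ℝ) < Fintype.card G := by exact_mod_cast Fintype.card_pos
    set N : ℝ := (Fintype.card G : ℝ) with hNdef
    let avg : (Fin n → G) → ℝ := fun r => (∑ g, f (Fin.cons g r)) / N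
    have havg : ∀ r, ∑ g, f (Fin.cons g r) = N * avg r := fun r => by
      simp only [avg]; field_simp
    have hdev : ∀ g r, |f (Fin.cons g r) - avg r| ≤ c := by
      intro g r
      have : f (Fin.cons g r) - avg r = (∑ g', (f (Fin.cons g r) - f (Fin.cons g' r))) / N := by
        rw [Finset.sum_sub_distrib, havg]
        simp only [Finset.sum_const, Finset.card_univ, nsmul_eq_mul, ← hNdef]
        field_simp
      rw [this, abs_div, abs_of_pos hN, div_le_iff₀ hN]
      refine (Finset.abs_sum_le_sum_abs _ _).trans ?_
      refine (Finset.sum_le_card_nsmul _ _ c fun g' _ => ?_).trans (by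
        simp [← hNdef, mul_comm])
      simpa using hf (Fin.cons g r) 0 g'
    obtain ⟨m, hm⟩ := ih avg (by
      intro r k y
      have : avg r - avg (Function.update r k y)
          = (∑ g, (f (Fin.cons g r) - f (Fin.cons g (Function.update r k y)))) / N := by
        rw [Finset.sum_sub_distrib, havg, havg]
        field_simp
      rw [this, abs_div, abs_of_pos hN, div_le_iff₀ hN]
      refine (Finset.abs_sum_le_sum_abs _ _).trans ?_
      refine (Finset.sum_le_card_nsmul _ _ c fun g _ => ?_).trans (by
        simp [← hNdef, mul_comm])
      simpa [Fin.cons_update] using hf (Fin.cons g r) k.succ y)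
    refine ⟨m, ?_⟩
    have hfiber : ∀ r, ∑ g, (f (Fin.cons g r) - m) ^ 2 ≤ N * c ^ 2 + N * (avg r - m) ^ 2 := by
      intro r
      have h1 : ∀ g, (f (Fin.cons g r) - m) ^ 2
          ≤ c ^ 2 + 2 * (avg r - m) * (f (Fin.cons g r) - avg r) + (avg r - m) ^ 2 := fun g => by
        have := sq_le_sq' (abs_le.1 (hdev g r)).1 (abs_le.1 (hdev g r)).2
        nlinarith
      refine (Finset.sum_le_sum fun g _ => h1 g).trans (le_of_eq ?_)
      rw [Finset.sum_add_distrib, Finset.sum_add_distrib, ← Finset.mul_sum,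
        Finset.sum_sub_distrib, havg]
      simp [← hNdef]
    rw [← (Fin.consEquiv fun _ : Fin (n + 1) => G).sum_comp, Fintype.sum_prod_type_right]
    refine (Finset.sum_le_sum fun r _ => hfiber r).trans ?_
    rw [Finset.sum_add_distrib, ← Finset.mul_sum Finset.univ (fun r => (avg r - m) ^ 2)]
    have := mul_le_mul_of_nonneg_left hm hN.le
    simp only [Finset.sum_const, Finset.card_univ, Fintype.card_fun, Fintype.card_fin,
      nsmul_eq_mul, Nat.cast_pow, ← hNdef]
    push_cast
    calc _ ≤ N ^ n * (N * c ^ 2) + N * (n * c ^ 2 * N ^ n) := add_le_add le_rfl this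
      _ = _ := by ring

theorem exists_perm_hom_of_freeGroup.{u} {ι : Type u} [Finite ι] [DecidableEq ι] (L : ℕ) :
    ∃ (V : Type u) (_ : Finite V) (φ : FreeGroup ι →* Equiv.Perm V),
      ∀ w : FreeGroup ι, w.toWord.length ≤ L → φ w = 1 → w = 1 := by
  classical
  let V := {w : FreeGroup ι // w.toWord.length ≤ L}
  have hV : Finite V := by
    have : Finite {l : List (ι × Bool) // l.length ≤ L} :=
      (List.finite_length_le (ι × Bool) L).to_subtype
    exact Finite.of_injective
      (fun v : V => (⟨v.1.toWord, v.2⟩ : {l : List (ι × Bool) // l.length ≤ L}))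
      fun v v' h => Subtype.ext (FreeGroup.toWord_injective (congrArg Subtype.val h))
  let e (i : ι) : {v : V // (FreeGroup.of i * v.1).toWord.length ≤ L} ≃
      {v : V // ((FreeGroup.of i)⁻¹ * v.1).toWord.length ≤ L} :=
    { toFun := fun v => ⟨⟨_, v.2⟩, by simpa using v.1.2⟩
      invFun := fun v => ⟨⟨_, v.2⟩, by simpa using v.1.2⟩
      left_inv := fun v => by ext; simp
      right_inv := fun v => by ext; simp }
  let σ (i : ι) : Equiv.Perm V := (e i).extendSubtype
  have hσ : ∀ i (v v' : V), v'.1 = FreeGroup.of i * v.1 → σ i v = v' := by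
    intro i v v' h
    have hv : (FreeGroup.of i * v.1).toWord.length ≤ L := h ▸ v'.2
    rw [show σ i v = _ from (e i).extendSubtype_apply_of_mem v hv]
    exact Subtype.ext h.symm
  have hone : (1 : FreeGroup ι).toWord.length ≤ L := by simp
  have key : ∀ (l : List (ι × Bool)) (_ : l.length ≤ L) (v : V), v.1 = FreeGroup.mk l →
      FreeGroup.lift σ (FreeGroup.mk l) ⟨1, hone⟩ = v := by
    intro l
    induction l with
    | nil =>
      intro _ v hv
      rw [← FreeGroup.one_eq_mk, map_one]
      exact Subtype.ext hv.symm
    | cons x l ih =>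
      intro hl v hv
      have hl' : l.length ≤ L := by simp at hl; omega
      let u : V := ⟨FreeGroup.mk l, FreeGroup.norm_mk_le.trans hl'⟩
      have hu := ih hl' u rfl
      obtain ⟨i, s⟩ := x
      have hmk : FreeGroup.mk ((i, s) :: l) = FreeGroup.mk [(i, s)] * FreeGroup.mk l := by simp
      rw [hmk] at hv ⊢
      rw [map_mul, Equiv.Perm.mul_apply, hu]
      cases s with
      | true =>
        have : FreeGroup.lift σ (FreeGroup.mk [(i, true)]) = σ i := FreeGroup.lift_apply_of
        rw [this]
        exact hσ i u v hv
      | false =>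
        have h2 : FreeGroup.mk [(i, false)] = (FreeGroup.of i)⁻¹ := rfl
        rw [h2] at hv ⊢
        rw [map_inv, FreeGroup.lift_apply_of, Equiv.Perm.inv_eq_iff_eq]
        exact (hσ i v u (by rw [hv]; simp [u])).symm
  refine ⟨V, hV, FreeGroup.lift σ, fun w hw h => ?_⟩
  have := key w.toWord hw ⟨w, hw⟩ FreeGroup.mk_toWord.symm
  rw [FreeGroup.mk_toWord, h] at this
  exact (congrArg Subtype.val this).symm

section CayleyMetric

variable {X A B ι G : Type*} [MetricSpace B] [Group G]

/-- `r` is the length of a chain from `(1, b₀)` to `(g, b)` in `G × B`, the copies `{g} × B` of `B`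
being glued along the points of `p`, and `(g, e i s a)` being at distance `δ` from
`(φ (i, s) * g, e i (!s) a)`. Lengths are capped at `D`. -/
inductive ChainLength (φ : FreeGroup ι →* G) (e : ι → Bool → A → B) (p : X → B) (δ D : ℝ)
    (b₀ : B) : G → B → ℝ → Prop
  | base : ChainLength φ e p δ D b₀ 1 b₀ 0
  | cap (g : G) (b : B) : ChainLength φ e p δ D b₀ g b D
  | move {g : G} {b : B} {r : ℝ} (b' : B) :
      ChainLength φ e p δ D b₀ g b r → ChainLength φ e p δ D b₀ g b' (r + dist b b')
  | jump {g : G} {r : ℝ} (x : X) (g' : G) :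
      ChainLength φ e p δ D b₀ g (p x) r → ChainLength φ e p δ D b₀ g' (p x) r
  | step {g : G} {r : ℝ} (i : ι) (s : Bool) (a : A) :
      ChainLength φ e p δ D b₀ g (e i s a) r →
        ChainLength φ e p δ D b₀ (φ (FreeGroup.mk [(i, s)]) * g) (e i (!s) a) (r + δ)

/-- The chains from `b₀` to `b` of length at most `r` that follow the word `l`. -/
def WordChain (e : ι → Bool → A → B) (δ : ℝ) (b₀ : B) : List (ι × Bool) → B → ℝ → Prop
  | [], b, r => dist b₀ b ≤ r
  | x :: l, b, r => ∃ a, WordChain e δ b₀ l (e x.1 x.2 a) (r - δ - dist (e x.1 (!x.2) a) b)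

variable {φ : FreeGroup ι →* G} {e : ι → Bool → A → B} {p : X → B} {δ D : ℝ} {b₀ : B}

theorem WordChain.move {l : List (ι × Bool)} {b b' : B} {r r' : ℝ} (h : WordChain e δ b₀ l b r)
    (hr : r + dist b b' ≤ r') : WordChain e δ b₀ l b' r' := by
  induction l generalizing b b' r r' with
  | nil => exact (dist_triangle _ b _).trans (by simp only [WordChain] at h; linarith)
  | cons x l ih =>
    obtain ⟨a, ha⟩ := h
    refine ⟨a, ih ha ?_⟩
    rw [dist_self]
    linarith [dist_triangle (e x.1 (!x.2) a) b b']

theorem WordChain.length_mul_le {l : List (ι × Bool)} {b : B} {r : ℝ}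
    (h : WordChain e δ b₀ l b r) : l.length * δ ≤ r := by
  induction l generalizing b r with
  | nil => simpa using dist_nonneg.trans h
  | cons x l ih =>
    obtain ⟨a, ha⟩ := h
    have := ih ha
    push_cast [List.length_cons]
    linarith [dist_nonneg (x := e x.1 (!x.2) a) (y := b)]

theorem WordChain.dist_le (hδ : 0 ≤ δ) {q : B}
    (hq : ∀ i s a, dist (e i s a) q = dist (e i (!s) a) q)
    {l : List (ι × Bool)} {b : B} {r : ℝ} (h : WordChain e δ b₀ l b r) :
    dist b₀ q ≤ r + dist b q := by
  induction l generalizing b r with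
  | nil => exact (dist_triangle _ b _).trans (by simp only [WordChain] at h; linarith)
  | cons x l ih =>
    obtain ⟨a, ha⟩ := h
    have := ih ha
    rw [hq] at this
    linarith [dist_triangle (e x.1 (!x.2) a) b q]

theorem WordChain.step [DecidableEq ι]
    (he : ∀ i s a a', dist (e i s a) (e i s a') = dist (e i (!s) a) (e i (!s) a'))
    {w : FreeGroup ι} {i : ι} {s : Bool} {a : A} {r : ℝ} (hδ : 0 ≤ δ)
    (h : WordChain e δ b₀ w.toWord (e i s a) r) :
    WordChain e δ b₀ (FreeGroup.mk [(i, s)] * w).toWord (e i (!s) a) (r + δ) := by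
  have hw : (FreeGroup.mk [(i, s)] * w).toWord = FreeGroup.reduce ((i, s) :: w.toWord) := by
    rw [FreeGroup.toWord_mul, FreeGroup.toWord_mk, FreeGroup.reduce_singleton]
    rfl
  rw [hw, FreeGroup.reduce.cons, FreeGroup.reduce_toWord]
  have extend : WordChain e δ b₀ ((i, s) :: w.toWord) (e i (!s) a) (r + δ) :=
    ⟨a, by simpa using h⟩
  generalize w.toWord = l at h extend
  cases l with
  | nil => exact extend
  | cons y l =>
    dsimp only
    split_ifs with hc
    · obtain ⟨j, t⟩ := y
      obtain ⟨rfl, rfl⟩ := hc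
      obtain ⟨a', ha'⟩ := h
      simp only [Bool.not_not] at ha' ⊢
      exact ha'.move (by rw [he]; simp only [Bool.not_not]; linarith)
    · exact extend

theorem ChainLength.nonneg (hδ : 0 ≤ δ) (hD : 0 ≤ D) {g : G} {b : B} {r : ℝ}
    (h : ChainLength φ e p δ D b₀ g b r) : 0 ≤ r := by
  induction h with
  | base => exact le_rfl
  | cap => exact hD
  | move => positivity
  | jump => assumption
  | step => positivity

theorem ChainLength.cases_word [DecidableEq ι] (hδ : 0 ≤ δ)
    (he : ∀ i s a a', dist (e i s a) (e i s a') = dist (e i (!s) a) (e i (!s) a'))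
    (hp : ∀ i s a x, dist (e i s a) (p x) = dist (e i (!s) a) (p x))
    {g : G} {b : B} {r : ℝ} (h : ChainLength φ e p δ D b₀ g b r) :
    D ≤ r ∨ (∃ x, dist b₀ (p x) + dist b (p x) ≤ r) ∨
      ∃ w : FreeGroup ι, φ w = g ∧ WordChain e δ b₀ w.toWord b r := by
  induction h with
  | base => exact .inr (.inr ⟨1, map_one φ, by simp [WordChain]⟩)
  | cap => exact .inl le_rfl
  | @move g b r b' _ ih =>
    obtain h | ⟨x, hx⟩ | ⟨w, hw, hwc⟩ := ih
    · exact .inl (by linarith [dist_nonneg (x := b) (y := b')])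
    · exact .inr (.inl ⟨x, by linarith [dist_triangle_left b' (p x) b]⟩)
    · exact .inr (.inr ⟨w, hw, hwc.move le_rfl⟩)
  | @jump g r x g' _ ih =>
    obtain h | ⟨y, hy⟩ | ⟨w, -, hwc⟩ := ih
    · exact .inl h
    · exact .inr (.inl ⟨y, hy⟩)
    · refine .inr (.inl ⟨x, ?_⟩)
      simpa using hwc.dist_le hδ fun i s a => hp i s a x
  | @step g r i s a _ ih =>
    obtain h | ⟨x, hx⟩ | ⟨w, hw, hwc⟩ := ih
    · exact .inl (by linarith)
    · exact .inr (.inl ⟨x, by rw [← hp]; linarith⟩)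
    · exact .inr (.inr ⟨_, by rw [map_mul, hw], hwc.step he hδ⟩)

theorem ChainLength.dist_le [DecidableEq ι] (hδ : 0 ≤ δ)
    (he : ∀ i s a a', dist (e i s a) (e i s a') = dist (e i (!s) a) (e i (!s) a'))
    (hp : ∀ i s a x, dist (e i s a) (p x) = dist (e i (!s) a) (p x))
    (hD : ∀ b b' : B, dist b b' ≤ D) {L : ℕ} (hL : D ≤ L * δ)
    (hφ : ∀ w : FreeGroup ι, w.toWord.length ≤ L → φ w = 1 → w = 1)
    {b : B} {r : ℝ} (h : ChainLength φ e p δ D b₀ 1 b r) : dist b₀ b ≤ r := by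
  obtain h | ⟨x, hx⟩ | ⟨w, hw, hwc⟩ := h.cases_word hδ he hp
  · exact (hD _ _).trans h
  · exact (dist_triangle_right _ _ (p x)).trans hx
  · obtain hle | hlt := le_total w.toWord.length L
    · obtain rfl := hφ w hle hw
      simpa [WordChain] using hwc
    · have : (L : ℝ) * δ ≤ w.toWord.length * δ := by gcongr
      linarith [hwc.length_mul_le, hD b₀ b]

/-- The length of a shortest chain from `(1, b₀)` to `(g, b)`. -/
noncomputable def chainDist (φ : FreeGroup ι →* G) (e : ι → Bool → A → B) (p : X → B) (δ D : ℝ)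
    (b₀ : B) (g : G) (b : B) : ℝ :=
  sInf {r | ChainLength φ e p δ D b₀ g b r}

theorem ChainLength.chainDist_le (hδ : 0 ≤ δ) (hD : 0 ≤ D) {g : G} {b : B} {r : ℝ}
    (h : ChainLength φ e p δ D b₀ g b r) : chainDist φ e p δ D b₀ g b ≤ r :=
  csInf_le ⟨0, fun _ h => h.nonneg hδ hD⟩ h

theorem le_chainDist {g : G} {b : B} {c : ℝ}
    (h : ∀ r, ChainLength φ e p δ D b₀ g b r → c ≤ r) : c ≤ chainDist φ e p δ D b₀ g b :=
  le_csInf ⟨D, .cap g b⟩ h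

theorem chainDist_mem_Icc (hδ : 0 ≤ δ) (hD : 0 ≤ D) (g : G) (b : B) :
    chainDist φ e p δ D b₀ g b ∈ Icc 0 D :=
  ⟨le_chainDist fun _ h => h.nonneg hδ hD, (ChainLength.cap g b).chainDist_le hδ hD⟩

theorem chainDist_le_add {g g' : G} {b b' : B} {c : ℝ} (hδ : 0 ≤ δ) (hD : 0 ≤ D)
    (h : ∀ r, ChainLength φ e p δ D b₀ g b r → ChainLength φ e p δ D b₀ g' b' (r + c)) :
    chainDist φ e p δ D b₀ g' b' ≤ chainDist φ e p δ D b₀ g b + c :=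
  sub_le_iff_le_add.1 <| le_chainDist fun r hr =>
    sub_le_iff_le_add.2 <| (h r hr).chainDist_le hδ hD

theorem abs_chainDist_sub_le (hδ : 0 ≤ δ) (hD : 0 ≤ D) (g : G) (b b' : B) :
    |chainDist φ e p δ D b₀ g b - chainDist φ e p δ D b₀ g b'| ≤ dist b b' := by
  have h₁ := chainDist_le_add (φ := φ) (e := e) (p := p) (b₀ := b₀) (g := g) hδ hD
    fun r hr => hr.move (b := b) b'
  have h₂ := chainDist_le_add (φ := φ) (e := e) (p := p) (b₀ := b₀) (g := g) hδ hD
    fun r hr => hr.move (b := b') b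
  rw [dist_comm b' b] at h₂
  exact abs_sub_le_iff.2 ⟨by linarith, by linarith⟩

theorem chainDist_glue (hδ : 0 ≤ δ) (hD : 0 ≤ D) (g g' : G) (x : X) :
    chainDist φ e p δ D b₀ g (p x) = chainDist φ e p δ D b₀ g' (p x) :=
  le_antisymm (le_chainDist fun _ h => (h.jump x g).chainDist_le hδ hD)
    (le_chainDist fun _ h => (h.jump x g').chainDist_le hδ hD)

theorem abs_chainDist_step_sub_le (hδ : 0 ≤ δ) (hD : 0 ≤ D) (g : G) (i : ι) (a : A) :
    |chainDist φ e p δ D b₀ g (e i true a) -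
      chainDist φ e p δ D b₀ (φ (FreeGroup.of i) * g) (e i false a)| ≤ δ := by
  have h₁ := chainDist_le_add (φ := φ) (e := e) (p := p) (b₀ := b₀) (g := g) hδ hD
    fun r hr => hr.step i true a
  have h₂ := chainDist_le_add (φ := φ) (e := e) (p := p) (b₀ := b₀)
    (g := φ (FreeGroup.of i) * g) hδ hD fun r hr => hr.step i false a
  have hinv : φ (FreeGroup.mk [(i, false)]) * (φ (FreeGroup.of i) * g) = g := by
    rw [show FreeGroup.mk [(i, false)] = (FreeGroup.of i)⁻¹ from rfl, map_inv,
      inv_mul_cancel_left]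
  rw [hinv] at h₂
  change chainDist φ e p δ D b₀ (φ (FreeGroup.of i) * g) (e i false a) ≤ _ at h₁
  change chainDist φ e p δ D b₀ g (e i true a) ≤ _ at h₂
  exact abs_sub_le_iff.2 ⟨by linarith, by linarith⟩

theorem chainDist_one_self (hδ : 0 ≤ δ) (hD : 0 ≤ D) : chainDist φ e p δ D b₀ 1 b₀ = 0 :=
  le_antisymm (ChainLength.base.chainDist_le hδ hD) (chainDist_mem_Icc hδ hD 1 b₀).1

end CayleyMetric

theorem exists_almost_invariant_family.{u, v, w, z} {X : Type u} {A : Type v} {B : Type w}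
    {ι : Type z} [MetricSpace A] [MetricSpace B] [Finite B] [Finite ι] {p : X → B} {α₀ : A → B}
    {α : ι → A → B} (hα₀ : Isometry α₀) (hα : ∀ i, Isometry (α i))
    (hp : ∀ i a x, dist (α i a) (p x) = dist (α₀ a) (p x)) {δ D : ℝ} (hδ : 0 < δ) (hD₀ : 0 ≤ D)
    (hD : ∀ b b' : B, dist b b' ≤ D) :
    ∃ (G : Type z) (_ : Fintype G) (_ : Nonempty G) (T : ι → Equiv.Perm G)
      (J : Type (max w z)) (_ : Fintype J) (Φ : G → B → J → ℝ),
      (∀ g, Isometry (Φ g)) ∧ (∀ g g' x, Φ g (p x) = Φ g' (p x)) ∧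
      (∀ g i a, dist (Φ g (α i a)) (Φ (T i g) (α₀ a)) ≤ δ) ∧
      ∀ g g' b b', dist (Φ g b) (Φ g' b') ≤ D := by
  classical
  obtain ⟨L, hL⟩ := exists_nat_ge (D / δ)
  rw [div_le_iff₀ hδ] at hL
  obtain ⟨V, _, φ, hφ⟩ := exists_perm_hom_of_freeGroup (ι := ι) L
  have := Fintype.ofFinite B
  have := Fintype.ofFinite (Equiv.Perm V)
  let e (i : ι) (s : Bool) : A → B := cond s (α i) α₀
  have he : ∀ i s a a', dist (e i s a) (e i s a') = dist (e i (!s) a) (e i (!s) a') := by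
    rintro i (_ | _) a a' <;> simp [e, hα₀.dist_eq, (hα i).dist_eq]
  have hp' : ∀ i s a x, dist (e i s a) (p x) = dist (e i (!s) a) (p x) := by
    rintro i (_ | _) a x <;> simp [e, hp]
  refine ⟨Equiv.Perm V, inferInstance, inferInstance, fun i => Equiv.mulLeft (φ (FreeGroup.of i)),
    Equiv.Perm V × B, inferInstance,
    fun g b j => chainDist φ e p δ D j.2 (g * j.1⁻¹) b, fun g => ?_, fun g g' x => ?_,
    fun g i a => ?_, fun g g' b b' => ?_⟩
  · refine Isometry.of_dist_eq fun b b' => le_antisymm ?_ ?_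
    · exact (dist_pi_le_iff dist_nonneg).2 fun j => abs_chainDist_sub_le hδ.le hD₀ _ _ _
    · refine le_trans ?_ (dist_le_pi_dist _ _ (g, b))
      simp only [mul_inv_cancel, Real.dist_eq]
      rw [chainDist_one_self hδ.le hD₀, zero_sub, abs_neg]
      exact (le_chainDist fun r hr => hr.dist_le hδ.le he hp' hD hL hφ).trans (le_abs_self _)
  · exact funext fun j => chainDist_glue hδ.le hD₀ _ _ x
  · refine (dist_pi_le_iff hδ.le).2 fun j => ?_
    simp only [Equiv.coe_mulLeft, mul_assoc]
    exact abs_chainDist_step_sub_le (e := e) hδ.le hD₀ _ i a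
  · refine (dist_pi_le_iff hD₀).2 fun j => ?_
    exact (Real.dist_le_of_mem_Icc (chainDist_mem_Icc hδ.le hD₀ _ b)
      (chainDist_mem_Icc hδ.le hD₀ _ b')).trans_eq (sub_zero D)

theorem exists_finMetricSpace_isometryEquiv (M : Type*) [MetricSpace M] [Finite M] :
    ∃ C : FinMetricSpace, Nonempty (M ≃ᵢ C.carrier) := by
  obtain ⟨n, ⟨e⟩⟩ := Finite.exists_equiv_fin M
  let _ : MetricSpace (Fin n) := MetricSpace.induced e.symm e.symm.injective inferInstance
  exact ⟨⟨Fin n⟩, ⟨⟨e, Isometry.of_dist_eq fun x y => by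
    change dist (e.symm (e x)) (e.symm (e y)) = _
    simp⟩⟩⟩

/-- The diagonal embedding attached to a tuple of maps, for the averaged `ℓ¹`-distance. -/
noncomputable def averageMap {G B E : Type*} [SeminormedAddCommGroup E] [NormedSpace ℝ E] {n : ℕ}
    (Φ : G → B → E) (g : Fin n → G) (b : B) : PiLp 1 fun _ : Fin n => E :=
  WithLp.toLp 1 fun k => (n : ℝ)⁻¹ • Φ (g k) b

theorem dist_averageMap {G B E : Type*} [SeminormedAddCommGroup E] [NormedSpace ℝ E] {n : ℕ}
    (Φ : G → B → E) (g g' : Fin n → G) (b b' : B) :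
    dist (averageMap Φ g b) (averageMap Φ g' b') =
      (∑ k, dist (Φ (g k) b) (Φ (g' k) b')) / n := by
  simp [averageMap, PiLp.dist_eq_of_L1, dist_smul₀, ← Finset.mul_sum, div_eq_inv_mul]

theorem embDist_le {A Y : Type*} [MetricSpace Y] {α β : A → Y} {c : ℝ} (hc : 0 ≤ c)
    (h : ∀ a, dist (α a) (β a) ≤ c) : embDist α β ≤ c :=
  Real.iSup_le h hc

/-- The approximate Ramsey property for finite metric spaces containing a fixed finite metric
space `X`, with embeddings fixing `X` pointwise: given `X ⊆ A ⊆ B` finite metric spaces, a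
nonempty finite set `F ⊆ Emb_X(A, B)` and `ε > 0`, there is a finite metric space `C`
containing `X` such that every coloring of `Emb_X(A, C)` has oscillation less than `ε` on
`{β ∘ α : α ∈ F}` for some `β ∈ Emb_X(B, C)`. -/
theorem finitePointedMetricSpaces_approximateRamsey
    (X A B : Type*) [MetricSpace X] [MetricSpace A] [MetricSpace B]
    [Finite X] [Finite A] [Finite B]
    (ιXA : X → A) (hιXA : Isometry ιXA) (ιAB : A → B) (hιAB : Isometry ιAB)
    (F : Set (A → B)) (hFfin : F.Finite) (hFne : F.Nonempty)
    (hF : ∀ α ∈ F, Isometry α ∧ ∀ x : X, α (ιXA x) = ιAB (ιXA x))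
    (ε : ℝ) (hε : 0 < ε) :
    ∃ (C : FinMetricSpace) (ιXC : X → C.carrier), Isometry ιXC ∧
      ∀ γ : (A → C.carrier) → ℝ,
        IsColoringOn {α : A → C.carrier | Isometry α ∧ ∀ x : X, α (ιXA x) = ιXC x} γ →
        ∃ β : B → C.carrier, Isometry β ∧ (∀ x : X, β (ιAB (ιXA x)) = ιXC x) ∧
          ∀ α ∈ F, ∀ α' ∈ F, |γ (β ∘ α) - γ (β ∘ α')| < ε := by
  classical
  have : Finite F := hFfin
  have := Fintype.ofFinite F
  obtain ⟨α₀, hα₀⟩ := hFne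
  obtain ⟨D, hD⟩ := (Set.toFinite (Set.range fun q : B × B => dist q.1 q.2)).bddAbove
  replace hD : ∀ b b' : B, dist b b' ≤ max D 0 := fun b b' =>
    (hD ⟨(b, b'), rfl⟩).trans (le_max_left _ _)
  have hD₀ := le_max_right D 0
  generalize max D 0 = D at hD hD₀
  obtain ⟨δ, hδ, hδε⟩ : ∃ δ : ℝ, 0 < δ ∧ 4 * δ = ε := ⟨ε / 4, by positivity, by ring⟩
  have hfix : ∀ α ∈ F, ∀ a x, dist (α a) (ιAB (ιXA x)) = dist a (ιXA x) := fun α hα a x => by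
    rw [← (hF α hα).2 x, (hF α hα).1.dist_eq]
  obtain ⟨G, _, _, T, J, _, Φ, hΦ, hΦX, hΦT, hΦD⟩ :=
    exists_almost_invariant_family (p := fun x => ιAB (ιXA x)) (α := fun i : F => i.1)
      (hF α₀ hα₀).1 (fun i => (hF i i.2).1)
      (fun i a x => by rw [hfix i i.2, hfix α₀ hα₀]) hδ hD₀ hD
  obtain ⟨n, hn⟩ := exists_nat_gt (Fintype.card F * D ^ 2 / δ ^ 2)
  have hn₀ : (0 : ℝ) < n := lt_of_le_of_lt (by positivity) hn
  let S := Set.range fun q : (Fin n → G) × B => averageMap Φ q.1 q.2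
  obtain ⟨C, ⟨j⟩⟩ := exists_finMetricSpace_isometryEquiv S
  let β (g : Fin n → G) (b : B) : C.carrier := j ⟨averageMap Φ g b, ⟨(g, b), rfl⟩⟩
  have hdist : ∀ g g' b b',
      dist (β g b) (β g' b') = (∑ k, dist (Φ (g k) b) (Φ (g' k) b')) / n := fun g g' b b' =>
    (j.isometry.dist_eq _ _).trans (dist_averageMap Φ g g' b b')
  have hβ : ∀ g, Isometry (β g) := fun g => Isometry.of_dist_eq fun b b' => by
    rw [hdist]
    simp only [(hΦ _).dist_eq, Finset.sum_const, Finset.card_univ, Fintype.card_fin, nsmul_eq_mul]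
    field_simp
  have hβX : ∀ g g' x, β g (ιAB (ιXA x)) = β g' (ιAB (ιXA x)) := fun g g' x => by
    rw [← dist_eq_zero, hdist,
      Finset.sum_eq_zero fun k _ => by rw [hΦX (g k) (g' k) x, dist_self], zero_div]
  obtain ⟨g₀⟩ : Nonempty (Fin n → G) := inferInstance
  refine ⟨C, fun x => β g₀ (ιAB (ιXA x)), (hβ g₀).comp (hιAB.comp hιXA), fun γ hγ => ?_⟩
  have hmem : ∀ g, ∀ α ∈ F, β g ∘ α ∈ {α : A → C.carrier | Isometry α ∧
      ∀ x : X, α (ιXA x) = β g₀ (ιAB (ιXA x))} := fun g α hα =>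
    ⟨(hβ g).comp (hF α hα).1, fun x => by
      rw [Function.comp_apply, (hF α hα).2]
      exact hβX _ _ _⟩
  have hT : ∀ g (i : F), |γ (β g ∘ i.1) - γ (β (fun k => T i (g k)) ∘ α₀)| ≤ δ := fun g i =>
    (hγ.2 _ (hmem g i i.2) _ (hmem _ α₀ hα₀)).trans <| embDist_le hδ.le fun a => by
      simp only [Function.comp_apply]
      rw [hdist, div_le_iff₀ hn₀]
      refine (Finset.sum_le_card_nsmul _ _ δ fun k _ => hΦT (g k) i a).trans ?_
      simp [mul_comm]
  obtain ⟨m, hm⟩ := exists_sum_sq_sub_le (c := D / n) n (fun g => γ (β g ∘ α₀)) (by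
    intro g k y
    refine (hγ.2 _ (hmem _ α₀ hα₀) _ (hmem _ α₀ hα₀)).trans <|
      embDist_le (by positivity) fun a => ?_
    simp only [Function.comp_apply]
    rw [hdist]
    gcongr
    rw [Finset.sum_eq_single k]
    · exact hΦD _ _ _ _
    · intro k' _ hk'
      simp [Function.update_of_ne hk']
    · simp)
  obtain ⟨g, hg⟩ : ∃ g : Fin n → G,
      ∑ i : F, (γ (β (fun k => T i (g k)) ∘ α₀) - m) ^ 2 < δ ^ 2 := by
    by_contra! hcon
    have h₁ := Finset.sum_le_sum fun g (_ : g ∈ Finset.univ) => hcon g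
    rw [Finset.sum_comm] at h₁
    have h₂ : ∀ i : F, ∑ g : Fin n → G, (γ (β (fun k => T i (g k)) ∘ α₀) - m) ^ 2
        = ∑ g : Fin n → G, (γ (β g ∘ α₀) - m) ^ 2 := fun i =>
      (Equiv.piCongrRight fun _ : Fin n => T i).sum_comp
        fun g : Fin n → G => (γ (β g ∘ α₀) - m) ^ 2
    simp only [h₂, Finset.sum_const, Finset.card_univ, Fintype.card_fun, Fintype.card_fin,
      nsmul_eq_mul, Nat.cast_pow] at h₁
    have hG : (0 : ℝ) < (Fintype.card G : ℝ) ^ n := by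
      have : 0 < Fintype.card G := Fintype.card_pos
      positivity
    have h₃ : (Fintype.card G : ℝ) ^ n * δ ^ 2 ≤
        (Fintype.card G : ℝ) ^ n * (Fintype.card F * D ^ 2 / n) := by
      refine h₁.trans ((mul_le_mul_of_nonneg_left hm (by positivity)).trans (le_of_eq ?_))
      field_simp
    have h₄ := le_of_mul_le_mul_left h₃ hG
    rw [div_lt_iff₀ (by positivity)] at hn
    rw [le_div_iff₀ hn₀] at h₄
    linarith
  have hclose : ∀ i : F, |γ (β g ∘ i.1) - m| < 2 * δ := fun i => by
    have h₁ : |γ (β (fun k => T i (g k)) ∘ α₀) - m| < δ :=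
      abs_lt_of_sq_lt_sq ((Finset.single_le_sum
        (f := fun i : F => (γ (β (fun k => T i (g k)) ∘ α₀) - m) ^ 2)
        (fun _ _ => sq_nonneg _) (Finset.mem_univ i)).trans_lt hg) hδ.le
    linarith [abs_sub_le (γ (β g ∘ i.1)) (γ (β (fun k => T i (g k)) ∘ α₀)) m, hT g i]
  refine ⟨β g, hβ g, fun x => hβX _ _ _, fun α hα α' hα' => ?_⟩
  have h₁ := hclose ⟨α, hα⟩
  have h₂ := hclose ⟨α', hα'⟩
  rw [abs_sub_comm] at h₂
  linarith [abs_sub_le (γ (β g ∘ α)) m (γ (β g ∘ α'))]
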